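/- (Correctness of the reduction underlying the undecidability of disjunctive mapping rewritability) Let Q be a Boolean CQ and ℛ a set of constant-free datalog rules on predicates 𝒫, and let (𝒬^{Q,ℛ}, ℳ^{Q,ℛ}) on (𝒮, 𝒯) be the associated reduction instance. Then ({Q}, ℛ) admits a UCQ-rewriting if and only if (𝒬^{Q,ℛ}, ℳ^{Q,ℛ}) admits a UCQ-𝒮-rewriting. -/

import Mathlib

/-! ## Basic syntax: terms, atoms, substitutions -/

/-- A term over variables `V` and constants `C`. -/
inductive FOTerm (V C : Type) where
  | var (v : V)
  | const (c : C)
deriving DecidableEq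

/-- An atom `p(t_1,...,t_n)`. -/
structure FOAtom (P V C : Type) where
  pred : P
  args : List (FOTerm V C)
deriving DecidableEq

/-- A substitution of variables by terms. -/
abbrev FOSubst (V C : Type) := V → FOTerm V C

variable {P V C : Type}

def FOTerm.applySub (u : FOSubst V C) : FOTerm V C → FOTerm V C
  | FOTerm.var v => u v
  | FOTerm.const c => FOTerm.const c

def FOAtom.applySub (u : FOSubst V C) (a : FOAtom P V C) : FOAtom P V C :=
  ⟨a.pred, a.args.map (FOTerm.applySub u)⟩

def applySubFS [DecidableEq P] [DecidableEq V] [DecidableEq C]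
    (u : FOSubst V C) (S : Finset (FOAtom P V C)) : Finset (FOAtom P V C) :=
  S.image (FOAtom.applySub u)

def FOTerm.varsOf [DecidableEq V] : FOTerm V C → Finset V
  | FOTerm.var v => {v}
  | FOTerm.const _ => ∅

def FOAtom.varsOf [DecidableEq V] (a : FOAtom P V C) : Finset V :=
  a.args.foldr (fun t acc => t.varsOf ∪ acc) ∅

/-- Variables occurring in a finite set of atoms. -/
def varsFS [DecidableEq V] (S : Finset (FOAtom P V C)) : Finset V :=
  S.sup FOAtom.varsOf

/-- Terms occurring in a finite set of atoms. -/
def termsFS [DecidableEq V] [DecidableEq C] (S : Finset (FOAtom P V C)) :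
    Finset (FOTerm V C) :=
  S.sup (fun a => a.args.toFinset)

/-- `h` is a homomorphism from the atom set `S₁` to the atom set `S₂`. -/
def IsHom (h : FOSubst V C) (S₁ S₂ : Finset (FOAtom P V C)) : Prop :=
  ∀ a ∈ S₁, a.applySub h ∈ S₂

/-- `S₂ ⊨ S₁` for atom sets viewed as existentially closed conjunctions:
there is a homomorphism from `S₁` to `S₂`. -/
def EntailsFS (S₂ S₁ : Finset (FOAtom P V C)) : Prop :=
  ∃ h : FOSubst V C, IsHom h S₁ S₂

/-! ## Disjunctive existential rules, triggers, chase step α -/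

/-- A disjunctive existential rule `B → H₁ ∨ ... ∨ Hₙ`. -/
structure DisjRule (P V C : Type) where
  body : Finset (FOAtom P V C)
  heads : List (Finset (FOAtom P V C))

/-- Well-formedness: non-empty body, at least one head disjunct, non-empty disjuncts. -/
def DisjRule.WF (R : DisjRule P V C) : Prop :=
  R.body.Nonempty ∧ R.heads ≠ [] ∧ ∀ H ∈ R.heads, H.Nonempty

/-- All variables of a rule. -/
def DisjRule.vars [DecidableEq V] (R : DisjRule P V C) : Finset V :=
  varsFS R.body ∪ R.heads.foldr (fun H acc => varsFS H ∪ acc) ∅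

/-- A trigger `(R, h)` on `F`: `h` is a homomorphism from the body of `R` to `F`. -/
def IsTrigger (R : DisjRule P V C) (h : FOSubst V C) (F : Finset (FOAtom P V C)) : Prop :=
  IsHom h R.body F

/-- `h'` is a safe extension of `h` for the head disjunct `H` of rule `R` w.r.t. the
fact base `F`: it agrees with `h` outside the existential variables of `H` and renames
the existential variables of `H` injectively to fresh variables. -/
def IsSafeExt [DecidableEq V] (F : Finset (FOAtom P V C)) (R : DisjRule P V C)
    (H : Finset (FOAtom P V C)) (h h' : FOSubst V C) : Prop :=
  (∀ v : V, v ∉ varsFS H \ varsFS R.body → h' v = h v) ∧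
  (∀ v ∈ varsFS H \ varsFS R.body, ∃ w : V, h' v = FOTerm.var w ∧ w ∉ varsFS F) ∧
  (∀ v ∈ varsFS H \ varsFS R.body, ∀ v' ∈ varsFS H \ varsFS R.body,
      h' v = h' v' → v = v')

/-- `L` is a result of the application `α_∨(F, R, h)` of the trigger `(R, h)` on `F`:
its `i`-th element is `F ∪ h^{safeᵢ}(Hᵢ)`. -/
def IsAlpha [DecidableEq P] [DecidableEq V] [DecidableEq C]
    (F : Finset (FOAtom P V C)) (R : DisjRule P V C) (h : FOSubst V C)
    (L : List (Finset (FOAtom P V C))) : Prop :=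
  L.length = R.heads.length ∧
  ∀ (i : ℕ) (hi : i < L.length) (hi' : i < R.heads.length),
    ∃ h' : FOSubst V C, IsSafeExt F R (R.heads.get ⟨i, hi'⟩) h h' ∧
      L.get ⟨i, hi⟩ = F ∪ applySubFS h' (R.heads.get ⟨i, hi'⟩)

/-! ## Partitions of terms (as equivalence relations), piece-unifiers -/

/-- A relation on terms, representing a partition of a set of terms (two terms are
related iff they belong to the same class). -/
abbrev TRel (V C : Type) := FOTerm V C → FOTerm V C → Prop

/-- Admissibility of a partition: no class contains two distinct constants. -/
def RelAdmissible (r : TRel V C) : Prop :=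
  ∀ c c' : C, r (FOTerm.const c) (FOTerm.const c') → c = c'

/-- `u` is a substitution associated with the partition represented by `r`:
it is constant on classes, maps each term to a member of its class (the selected term),
and gives priority to constants. -/
def IsAssocSub (r : TRel V C) (u : FOSubst V C) : Prop :=
  (∀ s t, r s t → s.applySub u = t.applySub u) ∧
  (∀ t, r t (t.applySub u)) ∧
  (∀ (v : V) (c : C), r (FOTerm.var v) (FOTerm.const c) → u v = FOTerm.const c)

/-- The data of a piece-unifier `(Q', H', P_u)`. -/
structure PieceUnif (P V C : Type) where
  Q' : Finset (FOAtom P V C)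
  H' : Finset (FOAtom P V C)
  rel : TRel V C

/-- `μ` is a piece-unifier of the CQ `Q` with the conjunctive rule `B → H`. -/
def IsPieceUnifier [DecidableEq P] [DecidableEq V] [DecidableEq C]
    (Q : Finset (FOAtom P V C)) (B H : Finset (FOAtom P V C))
    (μ : PieceUnif P V C) : Prop :=
  μ.Q'.Nonempty ∧ μ.Q' ⊆ Q ∧ μ.H' ⊆ H ∧
  Equivalence μ.rel ∧
  -- the partition is on the terms of Q' and H' (all other classes are singletons)
  (∀ s t, μ.rel s t → s = t ∨
      (s ∈ termsFS μ.Q' ∪ termsFS μ.H' ∧ t ∈ termsFS μ.Q' ∪ termsFS μ.H')) ∧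
  RelAdmissible μ.rel ∧
  -- classes containing an existential variable of H' contain otherwise only
  -- non-separating variables of Q'
  (∀ z ∈ varsFS μ.H' \ varsFS B, ∀ t, μ.rel (FOTerm.var z) t → t = FOTerm.var z ∨
      ∃ v : V, t = FOTerm.var v ∧ FOTerm.var v ∈ termsFS μ.Q' ∧ v ∉ varsFS (Q \ μ.Q')) ∧
  -- unification condition
  (∀ u : FOSubst V C, IsAssocSub μ.rel u → applySubFS u μ.Q' = applySubFS u μ.H')

/-- The join of a list of partitions (represented as relations): the equivalence
relation generated by their union. -/
def joinRel (rs : List (TRel V C)) : TRel V C :=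
  Relation.EqvGen (fun s t => ∃ r ∈ rs, r s t)

/-- The data of a disjunctive piece-unifier: the safe copies `Q₁, ..., Qₙ` together
with the conjunctive piece-unifiers `μ₁, ..., μₙ`. -/
structure DisjPieceUnif (P V C : Type) where
  Qs : List (Finset (FOAtom P V C))
  mus : List (PieceUnif P V C)

/-- The join of the partitions of a disjunctive piece-unifier. -/
def DisjPieceUnif.rel (μ : DisjPieceUnif P V C) : TRel V C :=
  joinRel (μ.mus.map PieceUnif.rel)

/-- `Qc` is a safe copy of `Q` (bijective renaming of its variables). -/
def IsSafeCopy [DecidableEq P] [DecidableEq V] [DecidableEq C]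
    (Q Qc : Finset (FOAtom P V C)) : Prop :=
  ∃ ρ : V → V, Function.Injective ρ ∧
    Qc = Q.image (FOAtom.applySub (fun v => FOTerm.var (ρ v)))

/-- `μ` is a disjunctive piece-unifier of the UCQ `𝒬` with the disjunctive rule `R`. -/
def IsDisjPieceUnifier [DecidableEq P] [DecidableEq V] [DecidableEq C]
    (𝒬 : Set (Finset (FOAtom P V C))) (R : DisjRule P V C)
    (μ : DisjPieceUnif P V C) : Prop :=
  μ.Qs.length = R.heads.length ∧ μ.mus.length = R.heads.length ∧
  -- each Qᵢ is a safe copy of a CQ of 𝒬, with variables disjoint from the rule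
  -- and from the other copies
  (∀ (i : ℕ) (hi : i < μ.Qs.length), ∃ Q ∈ 𝒬, IsSafeCopy Q (μ.Qs.get ⟨i, hi⟩)) ∧
  (∀ (i : ℕ) (hi : i < μ.Qs.length), Disjoint (varsFS (μ.Qs.get ⟨i, hi⟩)) R.vars) ∧
  (∀ (i j : ℕ) (hi : i < μ.Qs.length) (hj : j < μ.Qs.length), i ≠ j →
      Disjoint (varsFS (μ.Qs.get ⟨i, hi⟩)) (varsFS (μ.Qs.get ⟨j, hj⟩))) ∧
  -- each μᵢ is a piece-unifier of Qᵢ with B → Hᵢ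
  (∀ (i : ℕ) (hi : i < R.heads.length) (hi1 : i < μ.Qs.length) (hi2 : i < μ.mus.length),
      IsPieceUnifier (μ.Qs.get ⟨i, hi1⟩) R.body (R.heads.get ⟨i, hi⟩)
        (μ.mus.get ⟨i, hi2⟩)) ∧
  -- the join of the partitions is admissible
  RelAdmissible μ.rel

/-- `β_∨(𝒬, R, μ) = u(B) ∪ ⋃ᵢ u(Qᵢ ∖ Qᵢ')`, for `u` a substitution associated with
the join of the partitions of `μ`. -/
def betaRw [DecidableEq P] [DecidableEq V] [DecidableEq C]
    (R : DisjRule P V C) (μ : DisjPieceUnif P V C) (u : FOSubst V C) :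
    Finset (FOAtom P V C) :=
  applySubFS u R.body ∪
    (List.zipWith (fun Qi m => applySubFS u (Qi \ PieceUnif.Q' m)) μ.Qs μ.mus).foldr
      (· ∪ ·) ∅

/-! ## Semantics -/

/-- A first-order interpretation (with non-empty domain). -/
structure Interp (P V C : Type) where
  dom : Type
  nonempty : Nonempty dom
  rel : P → List dom → Prop
  cst : C → dom

def Interp.evalT (I : Interp P V C) (a : V → I.dom) : FOTerm V C → I.dom
  | FOTerm.var v => a v
  | FOTerm.const c => I.cst c

def Interp.satAtom (I : Interp P V C) (a : V → I.dom) (atm : FOAtom P V C) : Prop :=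
  I.rel atm.pred (atm.args.map (I.evalT a))

def Interp.satFS (I : Interp P V C) (a : V → I.dom) (S : Finset (FOAtom P V C)) : Prop :=
  ∀ atm ∈ S, I.satAtom a atm

/-- `I` is a model of the atom set `S` viewed as an existentially closed conjunction. -/
def Interp.modelsFB [DecidableEq V] (I : Interp P V C) (S : Finset (FOAtom P V C)) : Prop :=
  ∃ a : V → I.dom, I.satFS a S

/-- `I` satisfies the disjunctive existential rule `R`. -/
def Interp.satRule [DecidableEq V] (I : Interp P V C) (R : DisjRule P V C) : Prop :=
  ∀ a : V → I.dom, I.satFS a R.body →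
    ∃ H ∈ R.heads, ∃ a' : V → I.dom,
      (∀ v ∈ varsFS R.body, a' v = a v) ∧ I.satFS a' H

/-- First-order entailment `F, ℛ ⊨ 𝒬` of a UCQ from a fact base and a set of
disjunctive existential rules. -/
def SemEntails [DecidableEq V] (F : Finset (FOAtom P V C)) (ℛ : Set (DisjRule P V C))
    (𝒬 : Set (Finset (FOAtom P V C))) : Prop :=
  ∀ I : Interp P V C, I.modelsFB F → (∀ R ∈ ℛ, I.satRule R) →
    ∃ Q ∈ 𝒬, I.modelsFB Q

/-! ## Piece-rewriting -/

/-- `IsPieceRewriting ℛ 𝒬 𝒬'` holds when the UCQ `𝒬'` is obtained from the UCQ `𝒬`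
by a finite sequence of one-step piece-rewritings with rules of `ℛ`. -/
inductive IsPieceRewriting [DecidableEq P] [DecidableEq V] [DecidableEq C]
    (ℛ : Set (DisjRule P V C)) :
    Finset (Finset (FOAtom P V C)) → Finset (Finset (FOAtom P V C)) → Prop
  | refl (𝒬 : Finset (Finset (FOAtom P V C))) : IsPieceRewriting ℛ 𝒬 𝒬
  | step (𝒬 𝒬' : Finset (Finset (FOAtom P V C))) (R : DisjRule P V C)
      (μ : DisjPieceUnif P V C) (u : FOSubst V C) :
      IsPieceRewriting ℛ 𝒬 𝒬' → R ∈ ℛ →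
      IsDisjPieceUnifier (↑𝒬' : Set (Finset (FOAtom P V C))) R μ →
      IsAssocSub μ.rel u →
      IsPieceRewriting ℛ 𝒬 (insert (betaRw R μ u) 𝒬')

/-! ## The reduction from datalog UCQ-rewritability to disjunctive mapping
rewritability. Variables are natural numbers; `P0` is the set `𝒫` of predicates of
the datalog instance. -/

/-- The predicates of the reduction: `𝒮 = 𝒫 ∪ {T}` (constructors `base` and `T`)
and `𝒯 = {p̂ | p ∈ 𝒮} ∪ {p_{Rᵢ}}` (constructors `hat`, `hatT` and `pr`). -/
inductive RPred (P0 : Type) (n : ℕ) where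
  | base (p : P0)
  | T
  | hat (p : P0)
  | hatT
  | pr (i : Fin n)
deriving DecidableEq

/-- `p` is a source predicate (a predicate of `𝒮 = 𝒫 ∪ {T}`). -/
def RPred.isS {P0 : Type} {n : ℕ} : RPred P0 n → Prop
  | RPred.base _ => True
  | RPred.T => True
  | _ => False

/-- Renaming the predicate of an atom. -/
def FOAtom.mapPred {P P' V C : Type} (f : P → P') (a : FOAtom P V C) : FOAtom P' V C :=
  ⟨f a.pred, a.args⟩

/-- Embedding of atoms on `𝒫` as atoms on the reduction vocabulary. -/
def embedS {P0 C : Type} {n : ℕ} (a : FOAtom P0 ℕ C) : FOAtom (RPred P0 n) ℕ C :=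
  a.mapPred RPred.base

/-- The "hat" renaming of source predicates. -/
def hatFn {P0 : Type} {n : ℕ} : RPred P0 n → RPred P0 n
  | RPred.base p => RPred.hat p
  | RPred.T => RPred.hatT
  | q => q

/-- `Â`: rename all predicates of `A` with a hat. -/
def hatFS {P0 C : Type} {n : ℕ} [DecidableEq P0] [DecidableEq C]
    (S : Finset (FOAtom (RPred P0 n) ℕ C)) : Finset (FOAtom (RPred P0 n) ℕ C) :=
  S.image (FOAtom.mapPred hatFn)

/-- `A^T`: add an atom `T(t)` for every term `t` of `A`. -/
def addT {P0 C : Type} {n : ℕ} [DecidableEq P0] [DecidableEq C]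
    (S : Finset (FOAtom (RPred P0 n) ℕ C)) : Finset (FOAtom (RPred P0 n) ℕ C) :=
  S ∪ (termsFS S).image (fun t => ⟨RPred.T, [t]⟩)

/-- An atom/a set of atoms without constants. -/
def NoConstAtom {P V C : Type} (a : FOAtom P V C) : Prop :=
  ∀ t ∈ a.args, ∃ v : V, t = FOTerm.var v

def NoConstFS {P V C : Type} (S : Finset (FOAtom P V C)) : Prop :=
  ∀ a ∈ S, NoConstAtom a

/-- The frontier `x_i` of a datalog rule, as the list of the (pairwise distinct)
variables of its head atom. -/
def frontierList {P0 C : Type} (a : FOAtom P0 ℕ C) : List ℕ :=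
  (a.args.filterMap (fun t => match t with
    | FOTerm.var v => some v
    | FOTerm.const _ => none)).dedup

/-- A datalog rule `(B, H)` over `𝒫` viewed as a (disjunctive) existential rule. -/
def dlRule {P0 C : Type} (r : Finset (FOAtom P0 ℕ C) × FOAtom P0 ℕ C) :
    DisjRule P0 ℕ C :=
  ⟨r.1, [{r.2}]⟩

/-- The rule set `ℛ` viewed as a set of (disjunctive) existential rules. -/
def dlRules {P0 C : Type} (ℛ : List (Finset (FOAtom P0 ℕ C) × FOAtom P0 ℕ C)) :
    Set (DisjRule P0 ℕ C) :=
  { R | ∃ r ∈ ℛ, R = dlRule r }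

/-- The atom `p_{Rᵢ}(x_i)`. -/
def prAtom {P0 C : Type} [DecidableEq P0] [DecidableEq C]
    (ℛ : List (Finset (FOAtom P0 ℕ C) × FOAtom P0 ℕ C)) (i : Fin ℛ.length) :
    FOAtom (RPred P0 ℛ.length) ℕ C :=
  ⟨RPred.pr i, (frontierList (ℛ.get i).2).map FOTerm.var⟩

/-- The CQ `Q_{Rᵢ} = widehat((Bᵢ)^T) ∪ {p_{Rᵢ}(x_i)}`. -/
def QRi {P0 C : Type} [DecidableEq P0] [DecidableEq C]
    (ℛ : List (Finset (FOAtom P0 ℕ C) × FOAtom P0 ℕ C)) (i : Fin ℛ.length) :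
    Finset (FOAtom (RPred P0 ℛ.length) ℕ C) :=
  hatFS (addT ((ℛ.get i).1.image embedS)) ∪ {prAtom ℛ i}

/-- The CQ `Q_Q = widehat(Q^T)`. -/
def QQhat {P0 C : Type} [DecidableEq P0] [DecidableEq C] (n : ℕ)
    (Q : Finset (FOAtom P0 ℕ C)) : Finset (FOAtom (RPred P0 n) ℕ C) :=
  hatFS (addT (Q.image embedS))

/-- The UCQ `𝒬^{Q,ℛ} = {Q_Q} ∪ {Q_{Rᵢ} | Rᵢ ∈ ℛ}`. -/
def UCQred {P0 C : Type} [DecidableEq P0] [DecidableEq C]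
    (Q : Finset (FOAtom P0 ℕ C))
    (ℛ : List (Finset (FOAtom P0 ℕ C) × FOAtom P0 ℕ C)) :
    Finset (Finset (FOAtom (RPred P0 ℛ.length) ℕ C)) :=
  insert (QQhat ℛ.length Q) ((Finset.univ : Finset (Fin ℛ.length)).image (QRi ℛ))

/-- The disjunctive mapping rule `m_{Rᵢ} = T[x_i] → p_{Rᵢ}(x_i) ∨ Ĥᵢ(x_i)`. -/
def mRi {P0 C : Type} [DecidableEq P0] [DecidableEq C]
    (ℛ : List (Finset (FOAtom P0 ℕ C) × FOAtom P0 ℕ C)) (i : Fin ℛ.length) :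
    DisjRule (RPred P0 ℛ.length) ℕ C :=
  ⟨((frontierList (ℛ.get i).2).map
      (fun v => (⟨RPred.T, [FOTerm.var v]⟩ : FOAtom (RPred P0 ℛ.length) ℕ C))).toFinset,
   [{prAtom ℛ i}, {FOAtom.mapPred hatFn (embedS (ℛ.get i).2)}]⟩

/-- The translation rule `p(x⃗) → p̂(x⃗)` for `p ∈ 𝒫` (with arity `ar p`). -/
def transRule {P0 C : Type} (n : ℕ) (ar : P0 → ℕ) (p : P0) :
    DisjRule (RPred P0 n) ℕ C :=
  ⟨{⟨RPred.base p, (List.range (ar p)).map FOTerm.var⟩},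
   [{⟨RPred.hat p, (List.range (ar p)).map FOTerm.var⟩}]⟩

/-- The translation rule `T(x) → T̂(x)`. -/
def transT {P0 C : Type} (n : ℕ) : DisjRule (RPred P0 n) ℕ C :=
  ⟨{⟨RPred.T, [FOTerm.var 0]⟩}, [{⟨RPred.hatT, [FOTerm.var 0]⟩}]⟩

/-- The disjunctive mapping `ℳ^{Q,ℛ} = ℳ_ℛ ∪ ℳ_trans`. -/
def Mred {P0 C : Type} [DecidableEq P0] [DecidableEq C] (ar : P0 → ℕ)
    (ℛ : List (Finset (FOAtom P0 ℕ C) × FOAtom P0 ℕ C)) :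
    Set (DisjRule (RPred P0 ℛ.length) ℕ C) :=
  { R | ∃ i : Fin ℛ.length, R = mRi ℛ i } ∪
  { R | ∃ p : P0, R = transRule ℛ.length ar p } ∪ {transT ℛ.length}

/-- Isomorphism of CQs: bijective renaming of variables. -/
def IsoCQ {P V C : Type} [DecidableEq P] [DecidableEq V] [DecidableEq C]
    (Q₁ Q₂ : Finset (FOAtom P V C)) : Prop :=
  ∃ ρ : V → V, Function.Bijective ρ ∧
    Q₂ = Q₁.image (FOAtom.applySub (fun v => FOTerm.var (ρ v)))

section Semantics

theorem FOAtom.mem_varsOf [DecidableEq V] {a : FOAtom P V C} {v : V} :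
    v ∈ a.varsOf ↔ FOTerm.var v ∈ a.args := by
  obtain ⟨p, l⟩ := a
  simp only [FOAtom.varsOf]
  induction l with
  | nil => simp
  | cons t l ih =>
    rw [List.foldr_cons, Finset.mem_union, ih]
    cases t <;> simp [FOTerm.varsOf]

theorem mem_varsFS [DecidableEq V] {S : Finset (FOAtom P V C)} {v : V} :
    v ∈ varsFS S ↔ ∃ a ∈ S, FOTerm.var v ∈ a.args := by
  simp [varsFS, Finset.mem_sup, FOAtom.mem_varsOf]

theorem mem_termsFS [DecidableEq V] [DecidableEq C] {S : Finset (FOAtom P V C)}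
    {t : FOTerm V C} : t ∈ termsFS S ↔ ∃ a ∈ S, t ∈ a.args := by
  simp [termsFS, Finset.mem_sup]

theorem Interp.satAtom_congr (I : Interp P V C) {e e' : V → I.dom} {a : FOAtom P V C}
    (h : ∀ v, FOTerm.var v ∈ a.args → e v = e' v) : I.satAtom e a ↔ I.satAtom e' a := by
  have hargs : a.args.map (I.evalT e) = a.args.map (I.evalT e') := by
    refine List.map_congr_left fun t ht => ?_
    cases t with
    | var v => exact h v ht
    | const c => rfl
  rw [Interp.satAtom, Interp.satAtom, hargs]

theorem Interp.evalT_applySub (I : Interp P V C) (e : V → I.dom) (h : FOSubst V C)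
    (t : FOTerm V C) : I.evalT e (t.applySub h) = I.evalT (fun v => I.evalT e (h v)) t := by
  cases t <;> rfl

theorem Interp.satAtom_applySub (I : Interp P V C) (e : V → I.dom) (h : FOSubst V C)
    (a : FOAtom P V C) :
    I.satAtom e (a.applySub h) ↔ I.satAtom (fun v => I.evalT e (h v)) a := by
  simp [Interp.satAtom, FOAtom.applySub, Function.comp_def, I.evalT_applySub]

/-- Entailment from a fact base is preserved when the fact base is replaced by a
more specific one. -/
theorem SemEntails.of_entailsFS [DecidableEq V] {F F' : Finset (FOAtom P V C)}
    {ℛ : Set (DisjRule P V C)} {𝒬 : Set (Finset (FOAtom P V C))}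
    (h : SemEntails F ℛ 𝒬) (hF : EntailsFS F' F) : SemEntails F' ℛ 𝒬 := by
  rintro I ⟨e, he⟩ hR
  obtain ⟨g, hg⟩ := hF
  exact h I ⟨_, fun a ha => (I.satAtom_applySub e g a).1 (he _ (hg a ha))⟩ hR

end Semantics

section Reduction

variable {P0 C : Type} {n : ℕ}

theorem mem_frontierList {a : FOAtom P0 ℕ C} {v : ℕ} :
    v ∈ frontierList a ↔ FOTerm.var v ∈ a.args := by
  rw [frontierList, List.mem_dedup, List.mem_filterMap]
  constructor
  · rintro ⟨t, ht, h⟩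
    cases t <;> simp_all
  · intro h
    exact ⟨_, h, rfl⟩

variable [DecidableEq P0] [DecidableEq C]

theorem mem_addT_embedS {q : Finset (FOAtom P0 ℕ C)} {a : FOAtom (RPred P0 n) ℕ C} :
    a ∈ addT (q.image embedS) ↔
      (∃ b ∈ q, embedS b = a) ∨ ∃ b ∈ q, ∃ t ∈ b.args, ⟨RPred.T, [t]⟩ = a := by
  simp only [addT, Finset.mem_union, Finset.mem_image, mem_termsFS]
  refine or_congr_right ⟨?_, ?_⟩
  · rintro ⟨t, ⟨_, ⟨b, hb, rfl⟩, ht⟩, rfl⟩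
    exact ⟨b, hb, t, ht, rfl⟩
  · rintro ⟨b, hb, t, ht, rfl⟩
    exact ⟨t, ⟨_, ⟨b, hb, rfl⟩, ht⟩, rfl⟩

theorem isS_of_mem_addT_embedS {q : Finset (FOAtom P0 ℕ C)} {a : FOAtom (RPred P0 n) ℕ C}
    (ha : a ∈ addT (q.image embedS)) : RPred.isS a.pred := by
  rcases mem_addT_embedS.1 ha with ⟨b, -, rfl⟩ | ⟨b, -, t, -, rfl⟩ <;> trivial

theorem satFS_hatFS_addT_embedS (I : Interp (RPred P0 n) ℕ C) (e : ℕ → I.dom)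
    (q : Finset (FOAtom P0 ℕ C)) :
    I.satFS e (hatFS (addT (q.image embedS))) ↔
      ∀ b ∈ q, I.rel (RPred.hat b.pred) (b.args.map (I.evalT e)) ∧
        ∀ t ∈ b.args, I.rel RPred.hatT [I.evalT e t] := by
  constructor
  · intro h b hb
    refine ⟨h _ (Finset.mem_image_of_mem _ (mem_addT_embedS.2 (.inl ⟨b, hb, rfl⟩))),
      fun t ht => ?_⟩
    exact h _ (Finset.mem_image_of_mem _ (mem_addT_embedS.2 (.inr ⟨b, hb, t, ht, rfl⟩)))
  · intro h a ha
    obtain ⟨a, haT, rfl⟩ := Finset.mem_image.1 ha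
    rcases mem_addT_embedS.1 haT with ⟨b, hb, rfl⟩ | ⟨b, hb, t, ht, rfl⟩
    · exact (h b hb).1
    · exact (h b hb).2 t ht

/-- The facts on `𝒫` of a fact base on the reduction vocabulary all of whose terms are
marked by `T`. -/
def restrictT (F : Finset (FOAtom (RPred P0 n) ℕ C)) : Finset (FOAtom P0 ℕ C) :=
  (F.filter fun a => ∀ t ∈ a.args, ⟨RPred.T, [t]⟩ ∈ F).biUnion fun a =>
    match a.pred with
    | RPred.base p => {⟨p, a.args⟩}
    | _ => ∅

theorem mem_restrictT {F : Finset (FOAtom (RPred P0 n) ℕ C)} {b : FOAtom P0 ℕ C} :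
    b ∈ restrictT F ↔ embedS b ∈ F ∧ ∀ t ∈ b.args, ⟨RPred.T, [t]⟩ ∈ F := by
  simp only [restrictT, Finset.mem_biUnion, Finset.mem_filter]
  constructor
  · rintro ⟨⟨p, l⟩, ⟨haF, hT⟩, hb⟩
    cases p <;> simp at hb
    subst hb
    exact ⟨haF, hT⟩
  · rintro ⟨hb, hT⟩
    exact ⟨embedS b, ⟨hb, hT⟩, Finset.mem_singleton_self b⟩

theorem restrictT_addT_embedS (F : Finset (FOAtom P0 ℕ C)) :
    restrictT (addT (F.image embedS) : Finset (FOAtom (RPred P0 n) ℕ C)) = F := by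
  ext b
  simp only [mem_restrictT, mem_addT_embedS]
  constructor
  · rintro ⟨⟨b', hb', h⟩ | ⟨_, _, _, _, h⟩, -⟩
    · obtain ⟨p, l⟩ := b
      obtain ⟨p', l'⟩ := b'
      simp only [embedS, FOAtom.mapPred, FOAtom.mk.injEq, RPred.base.injEq] at h
      obtain ⟨rfl, rfl⟩ := h
      exact hb'
    · simp [embedS, FOAtom.mapPred] at h
  · intro hb
    exact ⟨.inl ⟨b, hb, rfl⟩, fun t ht => .inr ⟨b, hb, t, ht, rfl⟩⟩

theorem EntailsFS.restrictT {F q : Finset (FOAtom (RPred P0 n) ℕ C)} (h : EntailsFS F q) :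
    EntailsFS (restrictT F) (restrictT q) := by
  obtain ⟨h, hh⟩ := h
  refine ⟨h, fun b hb => ?_⟩
  rw [mem_restrictT] at hb ⊢
  refine ⟨hh _ hb.1, fun t ht => ?_⟩
  obtain ⟨s, hs, rfl⟩ := List.mem_map.1 ht
  exact hh _ (hb.2 s hs)

theorem EntailsFS.addT_embedS {F : Finset (FOAtom (RPred P0 n) ℕ C)}
    {q : Finset (FOAtom P0 ℕ C)} (h : EntailsFS (_root_.restrictT F) q) :
    EntailsFS F (addT (q.image embedS)) := by
  obtain ⟨h, hh⟩ := h
  refine ⟨h, fun a ha => ?_⟩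
  rcases mem_addT_embedS.1 ha with ⟨b, hb, rfl⟩ | ⟨b, hb, t, ht, rfl⟩
  · exact (mem_restrictT.1 (hh b hb)).1
  · exact (mem_restrictT.1 (hh b hb)).2 _ (List.mem_map_of_mem ht)

variable (ℛ : List (Finset (FOAtom P0 ℕ C) × FOAtom P0 ℕ C))

theorem satFS_mRi_body {i : Fin ℛ.length} {I : Interp (RPred P0 ℛ.length) ℕ C}
    {e : ℕ → I.dom} : I.satFS e (mRi ℛ i).body ↔
      ∀ v, FOTerm.var v ∈ (ℛ.get i).2.args → I.rel RPred.T [e v] := by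
  constructor
  · intro h v hv
    exact h ⟨RPred.T, [FOTerm.var v]⟩
      (List.mem_toFinset.2 (List.mem_map_of_mem (mem_frontierList.2 hv)))
  · intro h a ha
    obtain ⟨v, hv, rfl⟩ := List.mem_map.1 (List.mem_toFinset.1 ha)
    exact h v (mem_frontierList.1 hv)

theorem mem_varsFS_mRi_body {i : Fin ℛ.length} {v : ℕ}
    (hv : FOTerm.var v ∈ (ℛ.get i).2.args) : v ∈ varsFS (mRi ℛ i).body :=
  mem_varsFS.2 ⟨⟨RPred.T, [FOTerm.var v]⟩,
    List.mem_toFinset.2 (List.mem_map_of_mem (mem_frontierList.2 hv)), by simp⟩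

/-- A fact base on the reduction vocabulary whose `T`-marked part entails `Q` with `ℛ`
entails the reduced UCQ with the reduced mapping. -/
theorem semEntails_Mred_of_restrictT {ar : P0 → ℕ} {Q : Finset (FOAtom P0 ℕ C)}
    (hdl : ∀ r ∈ ℛ, r.2.varsOf ⊆ varsFS r.1 ∧ NoConstAtom r.2)
    (hQar : ∀ a ∈ Q, a.args.length = ar a.pred)
    (hRar : ∀ r ∈ ℛ, ∀ a ∈ r.1, a.args.length = ar a.pred)
    {F : Finset (FOAtom (RPred P0 ℛ.length) ℕ C)}
    (h : SemEntails (restrictT F) (dlRules ℛ) {Q}) :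
    SemEntails F (Mred ar ℛ) ↑(UCQred Q ℛ) := by
  rintro I ⟨e, he⟩ hM
  by_contra hno
  have hTT : ∀ d, I.rel RPred.T [d] → I.rel RPred.hatT [d] := by
    intro d hd
    obtain ⟨H, hH, e', he', hsat⟩ := hM (transT ℛ.length) (.inr rfl) (fun _ => d)
      (fun a ha => by
        rw [Finset.mem_singleton.1 ha]
        exact hd)
    rw [List.mem_singleton.1 hH] at hsat
    have h0 : e' 0 = d := he' 0 (mem_varsFS.2 ⟨_, Finset.mem_singleton_self _, by simp⟩)
    have := hsat _ (Finset.mem_singleton_self _)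
    simpa [Interp.satAtom, Interp.evalT, h0] using this
  have hbase : ∀ p l, I.rel (RPred.base p) l → l.length = ar p → I.rel (RPred.hat p) l := by
    intro p l hl hlen
    obtain ⟨d⟩ := I.nonempty
    have hmap : ∀ e' : ℕ → I.dom, (∀ k < ar p, e' k = l.getD k d) →
        ((List.range (ar p)).map (FOTerm.var (C := C))).map (I.evalT e') = l := by
      intro e' he'
      apply List.ext_getElem (by simp [hlen])
      intro k hk hk'
      simp only [List.getElem_map, List.getElem_range, Interp.evalT]
      rw [he' k (hlen ▸ hk'), List.getD_eq_getElem _ _ hk']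
    obtain ⟨H, hH, e', he', hsat⟩ := hM (transRule ℛ.length ar p) (.inl (.inr ⟨p, rfl⟩))
      (fun k => l.getD k d) (fun a ha => by
        rw [Finset.mem_singleton.1 ha, Interp.satAtom, hmap _ fun _ _ => rfl]
        exact hl)
    rw [List.mem_singleton.1 hH] at hsat
    have := hsat _ (Finset.mem_singleton_self _)
    rw [Interp.satAtom, hmap e' fun k hk =>
      he' k (mem_varsFS.2 ⟨_, Finset.mem_singleton_self _, by simpa using hk⟩)] at this
    exact this
  -- The `T`-marked part of `I`; the arity guard disposes of ill-formed facts.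
  let J : Interp P0 ℕ C :=
    { dom := I.dom
      nonempty := I.nonempty
      rel := fun p l => (l.length = ar p → I.rel (RPred.hat p) l) ∧
        ∀ d ∈ l, I.rel RPred.T [d]
      cst := I.cst }
  have heval : ∀ (e : ℕ → I.dom) (t : FOTerm ℕ C), J.evalT e t = I.evalT e t := by
    intro e t
    cases t <;> rfl
  have hsat : ∀ (e : ℕ → I.dom) (b : FOAtom P0 ℕ C), J.satAtom e b ↔
      (b.args.length = ar b.pred → I.rel (RPred.hat b.pred) (b.args.map (I.evalT e))) ∧
        ∀ t ∈ b.args, I.rel RPred.T [I.evalT e t] := by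
    intro e b
    simp [Interp.satAtom, J, funext (heval e)]
  have hhat : ∀ (e : ℕ → I.dom) (q : Finset (FOAtom P0 ℕ C)),
      (∀ a ∈ q, a.args.length = ar a.pred) → J.satFS e q →
      I.satFS e (hatFS (addT (q.image embedS))) := by
    intro e q hq hJ
    rw [satFS_hatFS_addT_embedS]
    intro b hb
    obtain ⟨h1, h2⟩ := (hsat e b).1 (hJ b hb)
    exact ⟨h1 (hq b hb), fun t ht => hTT _ (h2 t ht)⟩
  have hJF : J.modelsFB (restrictT F) := by
    refine ⟨e, fun b hb => (hsat e b).2 ?_⟩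
    obtain ⟨hbF, hT⟩ := mem_restrictT.1 hb
    exact ⟨fun hlen => hbase _ _ (he _ hbF) (by simpa using hlen), fun t ht => he _ (hT t ht)⟩
  have hJR : ∀ R ∈ dlRules ℛ, J.satRule R := by
    rintro _ ⟨r, hr, rfl⟩ e hB
    refine ⟨{r.2}, List.mem_singleton_self _, e, fun _ _ => rfl, fun a ha => ?_⟩
    rw [Finset.mem_singleton.1 ha, hsat]
    obtain ⟨i, rfl⟩ := List.get_of_mem hr
    have hT : ∀ v, FOTerm.var v ∈ (ℛ.get i).2.args → I.rel RPred.T [e v] := by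
      intro v hv
      obtain ⟨b, hb, hvb⟩ := mem_varsFS.1 ((hdl _ hr).1 (FOAtom.mem_varsOf.2 hv))
      exact ((hsat e b).1 (hB b hb)).2 _ hvb
    refine ⟨fun _ => ?_, fun t ht => ?_⟩
    · obtain ⟨H, hH, e', he', hsatH⟩ :=
        hM (mRi ℛ i) (.inl (.inl ⟨i, rfl⟩)) e ((satFS_mRi_body ℛ).2 hT)
      have hee : ∀ v, FOTerm.var v ∈ (ℛ.get i).2.args → e' v = e v :=
        fun v hv => he' v (mem_varsFS_mRi_body ℛ hv)
      rcases List.mem_cons.1 hH with rfl | hH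
      · refine (hno ⟨QRi ℛ i, by simp [UCQred], e, fun a ha => ?_⟩).elim
        rcases Finset.mem_union.1 ha with ha | ha
        · exact hhat e _ (hRar _ hr) hB a ha
        · rw [Finset.mem_singleton.1 ha]
          refine (I.satAtom_congr fun v hv => hee v ?_).1
            (hsatH _ (Finset.mem_singleton_self _))
          simpa [prAtom, mem_frontierList] using hv
      · rw [List.mem_singleton.1 hH] at hsatH
        exact (I.satAtom_congr hee).1 (hsatH _ (Finset.mem_singleton_self _))
    · obtain ⟨v, rfl⟩ := (hdl _ hr).2 t ht
      exact hT v ht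
  obtain ⟨q, rfl, e', he'⟩ := h J hJF hJR
  exact hno ⟨QQhat ℛ.length q, by simp [UCQred], e', hhat e' q hQar he'⟩

/-- If a fact base on `𝒮` entails the reduced UCQ with the reduced mapping, then its
`T`-marked part entails `Q` with `ℛ`. -/
theorem semEntails_restrictT_of_Mred {ar : P0 → ℕ} {Q : Finset (FOAtom P0 ℕ C)}
    (hdl : ∀ r ∈ ℛ, r.2.varsOf ⊆ varsFS r.1 ∧ NoConstAtom r.2)
    {F : Finset (FOAtom (RPred P0 ℛ.length) ℕ C)} (hF : ∀ a ∈ F, RPred.isS a.pred)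
    (h : SemEntails F (Mred ar ℛ) ↑(UCQred Q ℛ)) :
    SemEntails (restrictT F) (dlRules ℛ) {Q} := by
  rintro J ⟨e, he⟩ hR
  -- The Herbrand interpretation of `F` with hatted predicates pulled back from `J`;
  -- `p_{Rᵢ}` holds exactly where `Hᵢ` fails.
  let I : Interp (RPred P0 ℛ.length) ℕ C :=
    { dom := FOTerm ℕ C
      nonempty := ⟨FOTerm.var 0⟩
      rel := fun p l => match p with
        | RPred.base p => ⟨RPred.base p, l⟩ ∈ F
        | RPred.T => ⟨RPred.T, l⟩ ∈ F
        | RPred.hat p => ⟨RPred.base p, l⟩ ∈ F ∨ J.rel p (l.map (J.evalT e))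
        | RPred.hatT => ⟨RPred.T, l⟩ ∈ F
        | RPred.pr i => ∃ g : FOSubst ℕ C, l = (frontierList (ℛ.get i).2).map g ∧
            ¬ J.satAtom (fun v => J.evalT e (g v)) (ℛ.get i).2
      cst := FOTerm.const }
  have heval : ∀ (g : FOSubst ℕ C) (t : FOTerm ℕ C), I.evalT g t = t.applySub g := by
    intro g t
    cases t <;> rfl
  have hargs : ∀ (g : FOSubst ℕ C) (l : List (FOTerm ℕ C)),
      (l.map (I.evalT g)).map (J.evalT e) = l.map (J.evalT fun v => J.evalT e (g v)) := by
    intro g l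
    simp [Function.comp_def, heval, J.evalT_applySub]
  have hIF : I.modelsFB F := by
    refine ⟨FOTerm.var, fun a ha => ?_⟩
    have hid : a.args.map (I.evalT FOTerm.var) = a.args := by
      conv_rhs => rw [← List.map_id a.args]
      refine List.map_congr_left fun t _ => ?_
      cases t <;> rfl
    have hS := hF a ha
    rw [Interp.satAtom, hid]
    obtain ⟨p, l⟩ := a
    cases p with
    | base p => exact ha
    | T => exact ha
    | hat p => exact hS.elim
    | hatT => exact hS.elim
    | pr i => exact hS.elim
  have hIM : ∀ R ∈ Mred ar ℛ, I.satRule R := by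
    rintro _ ((⟨i, rfl⟩ | ⟨p, rfl⟩) | rfl) g hg
    · by_cases hH : J.satAtom (fun v => J.evalT e (g v)) (ℛ.get i).2
      · refine ⟨_, List.mem_cons_of_mem _ (List.mem_singleton_self _), g, fun _ _ => rfl,
          fun a ha => ?_⟩
        rw [Finset.mem_singleton.1 ha]
        refine Or.inr ?_
        rw [show (FOAtom.mapPred hatFn (embedS (ℛ.get i).2) :
          FOAtom (RPred P0 ℛ.length) ℕ C).args = (ℛ.get i).2.args from rfl, hargs]
        exact hH
      · refine ⟨_, List.mem_cons_self, g, fun _ _ => rfl, fun a ha => ?_⟩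
        rw [Finset.mem_singleton.1 ha]
        refine ⟨g, ?_, hH⟩
        simp [prAtom, Function.comp_def, Interp.evalT]
    · refine ⟨_, List.mem_singleton_self _, g, fun _ _ => rfl, fun a ha => ?_⟩
      rw [Finset.mem_singleton.1 ha]
      exact Or.inl (hg _ (Finset.mem_singleton_self _))
    · refine ⟨_, List.mem_singleton_self _, g, fun _ _ => rfl, fun a ha => ?_⟩
      rw [Finset.mem_singleton.1 ha]
      exact hg ⟨RPred.T, [FOTerm.var 0]⟩ (Finset.mem_singleton_self _)
  have hpull : ∀ (g : FOSubst ℕ C) (q : Finset (FOAtom P0 ℕ C)),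
      I.satFS g (hatFS (addT (q.image embedS))) →
      J.satFS (fun v => J.evalT e (g v)) q := by
    intro g q hq b hb
    obtain ⟨h1, h2⟩ := (satFS_hatFS_addT_embedS I g q).1 hq b hb
    rw [Interp.satAtom, ← hargs]
    rcases h1 with h1 | h1
    · refine he ⟨b.pred, b.args.map (I.evalT g)⟩ (mem_restrictT.2 ⟨h1, fun t ht => ?_⟩)
      obtain ⟨s, hs, rfl⟩ := List.mem_map.1 ht
      exact h2 s hs
    · exact h1
  obtain ⟨q, hq, g, hg⟩ := h I hIF hIM
  rcases Finset.mem_insert.1 (Finset.mem_coe.1 hq) with rfl | hq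
  · exact ⟨Q, rfl, _, hpull g Q hg⟩
  · obtain ⟨i, -, rfl⟩ := Finset.mem_image.1 hq
    have hr := List.get_mem ℛ i
    have hB := hpull g (ℛ.get i).1 fun a ha => hg a (Finset.mem_union_left _ ha)
    obtain ⟨g', hg', hno⟩ := hg (prAtom ℛ i)
      (Finset.mem_union_right _ (Finset.mem_singleton_self _))
    have hgg : ∀ v, FOTerm.var v ∈ (ℛ.get i).2.args → g v = g' v := by
      intro v hv
      simp only [prAtom, List.map_map, List.map_inj_left] at hg'
      exact hg' v (mem_frontierList.2 hv)
    obtain ⟨H, hH, e', he', hsat⟩ := hR _ ⟨_, hr, rfl⟩ _ hB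
    rw [List.mem_singleton.1 hH] at hsat
    refine (hno ((J.satAtom_congr fun v hv => ?_).1
      (hsat _ (Finset.mem_singleton_self _)))).elim
    rw [he' v ((hdl _ hr).1 (FOAtom.mem_varsOf.2 hv)), hgg v hv]

end Reduction

/-- correctness of the reduction: `({Q}, ℛ)` admits a UCQ-rewriting
iff `(𝒬^{Q,ℛ}, ℳ^{Q,ℛ})` admits a UCQ-`𝒮`-rewriting. -/
theorem stmt19 {P0 C : Type} [DecidableEq P0] [DecidableEq C]
    (ar : P0 → ℕ) (Q : Finset (FOAtom P0 ℕ C))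
    (ℛ : List (Finset (FOAtom P0 ℕ C) × FOAtom P0 ℕ C))
    -- ℛ is a set of constant-free datalog rules
    (hdl : ∀ r ∈ ℛ, r.1.Nonempty ∧ r.2.varsOf ⊆ varsFS r.1 ∧
        NoConstFS r.1 ∧ NoConstAtom r.2)
    -- atoms respect the arities of the vocabulary
    (hQar : ∀ a ∈ Q, a.args.length = ar a.pred)
    (hRar : ∀ r ∈ ℛ, (∀ a ∈ r.1, a.args.length = ar a.pred) ∧
        r.2.args.length = ar r.2.pred) :
    -- ({Q}, ℛ) admits a UCQ-rewriting ...
    (∃ 𝒬' : Finset (Finset (FOAtom P0 ℕ C)),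
       -- sound
       (∀ F : Finset (FOAtom P0 ℕ C), (∃ q ∈ 𝒬', EntailsFS F q) →
          SemEntails F (dlRules ℛ) ({Q} : Set (Finset (FOAtom P0 ℕ C)))) ∧
       -- complete
       (∀ F : Finset (FOAtom P0 ℕ C),
          SemEntails F (dlRules ℛ) ({Q} : Set (Finset (FOAtom P0 ℕ C))) →
            ∃ q ∈ 𝒬', EntailsFS F q))
    ↔
    -- ... iff (𝒬^{Q,ℛ}, ℳ^{Q,ℛ}) admits a UCQ-𝒮-rewriting
    (∃ 𝒬' : Finset (Finset (FOAtom (RPred P0 ℛ.length) ℕ C)),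
       -- all CQs of 𝒬' are on 𝒮
       (∀ q ∈ 𝒬', ∀ a ∈ q, RPred.isS a.pred) ∧
       -- sound
       (∀ F : Finset (FOAtom (RPred P0 ℛ.length) ℕ C),
          (∃ q ∈ 𝒬', EntailsFS F q) →
            SemEntails F (Mred ar ℛ)
              (↑(UCQred Q ℛ) : Set (Finset (FOAtom (RPred P0 ℛ.length) ℕ C)))) ∧
       -- complete w.r.t. fact bases on 𝒮
       (∀ F : Finset (FOAtom (RPred P0 ℛ.length) ℕ C),
          (∀ a ∈ F, RPred.isS a.pred) →
          SemEntails F (Mred ar ℛ)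
            (↑(UCQred Q ℛ) : Set (Finset (FOAtom (RPred P0 ℛ.length) ℕ C))) →
            ∃ q ∈ 𝒬', EntailsFS F q)) := by
  have hdl' : ∀ r ∈ ℛ, r.2.varsOf ⊆ varsFS r.1 ∧ NoConstAtom r.2 :=
    fun r hr => ⟨(hdl r hr).2.1, (hdl r hr).2.2.2⟩
  have hRar' : ∀ r ∈ ℛ, ∀ a ∈ r.1, a.args.length = ar a.pred := fun r hr => (hRar r hr).1
  constructor
  · rintro ⟨𝒬', hsound, hcomplete⟩
    refine ⟨𝒬'.image fun q => addT (q.image embedS), ?_, ?_, ?_⟩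
    · intro q hq a ha
      obtain ⟨q, -, rfl⟩ := Finset.mem_image.1 hq
      exact isS_of_mem_addT_embedS ha
    · rintro F ⟨_, hq', hFq⟩
      obtain ⟨q, hq, rfl⟩ := Finset.mem_image.1 hq'
      have hFq' := hFq.restrictT
      rw [restrictT_addT_embedS] at hFq'
      exact semEntails_Mred_of_restrictT ℛ hdl' hQar hRar' (hsound _ ⟨q, hq, hFq'⟩)
    · intro F hF hent
      obtain ⟨q, hq, hFq⟩ := hcomplete _ (semEntails_restrictT_of_Mred ℛ hdl' hF hent)
      exact ⟨_, Finset.mem_image_of_mem _ hq, hFq.addT_embedS⟩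
  · rintro ⟨𝒬', hS, hsound, hcomplete⟩
    refine ⟨𝒬'.image restrictT, ?_, ?_⟩
    · rintro F ⟨_, hq', hFq⟩
      obtain ⟨q, hq, rfl⟩ := Finset.mem_image.1 hq'
      have hqq : EntailsFS q q := ⟨FOTerm.var, fun a ha => by
        have hid : FOTerm.applySub (FOTerm.var : FOSubst ℕ C) = id := by
          funext t
          cases t <;> rfl
        simpa [FOAtom.applySub, hid] using ha⟩
      exact (semEntails_restrictT_of_Mred ℛ hdl' (hS q hq)
        (hsound q ⟨q, hq, hqq⟩)).of_entailsFS hFq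
    · intro F hent
      obtain ⟨q, hq, hFq⟩ := hcomplete (addT (F.image embedS))
        (fun a ha => isS_of_mem_addT_embedS ha)
        (semEntails_Mred_of_restrictT ℛ hdl' hQar hRar' (by rwa [restrictT_addT_embedS]))
      have hFq' := hFq.restrictT
      rw [restrictT_addT_embedS] at hFq'
      exact ⟨_, Finset.mem_image_of_mem _ hq, hFq'⟩
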